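/- arXiv:2307.06807 — 6 statements merged into one kernel-verified Lean document; each statement's English description precedes it below -/
import Mathlib

section
/- Suppose there exist an index a ∈ ℤ/nℤ and an integer ℓ with 1 ≤ ℓ ≤ n such that the indices a and a+ℓ both have type ∗ and, for every integer t with 0 < t < ℓ, the index a+t has type ∘. Then the map D is not surjective. (This is the case of the interval [∗,∗] in Lemma 5.2: a circular mapping cone containing a [∗,∗]-interval is not surjective.) -/
open Function

/-- A linear functional on `R × T`, with `R` a power series ring and `T` torsion, is
multiplication of the first coordinate by a scalar. -/
theorem linearMap_prod_torsion_apply {𝔽 T : Type*} [Field 𝔽] [AddCommGroup T]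
    [Module (PowerSeries 𝔽) T]
    (hT : ∀ x : T, ∃ r : PowerSeries 𝔽, r ≠ 0 ∧ r • x = 0)
    (f : (PowerSeries 𝔽 × T) →ₗ[PowerSeries 𝔽] PowerSeries 𝔽) (x : PowerSeries 𝔽 × T) :
    f x = x.1 * f (1, 0) := by
  have htors : f (0, x.2) = 0 := by
    obtain ⟨r, hr, hrx⟩ := hT x.2
    have hmul : r * f (0, x.2) = 0 := by
      rw [← smul_eq_mul, ← map_smul, Prod.smul_mk, hrx, smul_zero]
      exact map_zero f
    exact (mul_eq_zero.mp hmul).resolve_left hr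
  have hx : x = x.1 • ((1, 0) : PowerSeries 𝔽 × T) + (0, x.2) := by
    ext1 <;> simp
  conv_lhs => rw [hx, map_add, map_smul, htors, add_zero, smul_eq_mul]

theorem constantCoeff_eq_zero_of_not_surjective {𝔽 T : Type*} [Field 𝔽] [AddCommGroup T]
    [Module (PowerSeries 𝔽) T]
    (f : (PowerSeries 𝔽 × T) →ₗ[PowerSeries 𝔽] PowerSeries 𝔽) (hf : ¬ Surjective f)
    (x : PowerSeries 𝔽 × T) : PowerSeries.constantCoeff (f x) = 0 := by
  by_contra hne
  have hu : IsUnit (f x) := PowerSeries.isUnit_iff_constantCoeff.mpr (isUnit_iff_ne_zero.mpr hne)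
  obtain ⟨u, hu⟩ := hu
  refine hf fun y => ⟨(y * ↑u⁻¹) • x, ?_⟩
  rw [map_smul, ← hu, smul_eq_mul, Units.inv_mul_cancel_right]

theorem constantCoeff_ne_zero_of_surjective {𝔽 T : Type*} [Field 𝔽] [AddCommGroup T]
    [Module (PowerSeries 𝔽) T]
    (hT : ∀ x : T, ∃ r : PowerSeries 𝔽, r ≠ 0 ∧ r • x = 0)
    (f g : (PowerSeries 𝔽 × T) →ₗ[PowerSeries 𝔽] PowerSeries 𝔽) (hf : Surjective f)
    {x : PowerSeries 𝔽 × T} (hx : PowerSeries.constantCoeff (g x) ≠ 0) :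
    PowerSeries.constantCoeff (f x) ≠ 0 := by
  rw [linearMap_prod_torsion_apply hT, map_mul] at hx ⊢
  refine mul_ne_zero (left_ne_zero_of_mul hx) ?_
  obtain ⟨z, hz⟩ := hf 1
  rw [linearMap_prod_torsion_apply hT] at hz
  have hz' := congrArg PowerSeries.constantCoeff hz
  rw [map_mul, map_one] at hz'
  exact right_ne_zero_of_mul (hz' ▸ one_ne_zero)

/-- Lemma 5.2, interval [∗,∗]: a circular mapping cone containing a [∗,∗]-interval
is not surjective. Here `R = 𝔽[[U]]`, `A j = R × T j`, `B j = R × T' j` with `T j`, `T' j`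
torsion `R`-modules, `π j` is the projection to the first factor, and
`D a` at index `j+1` is `v (j+1) (a (j+1)) + h j (a j)`. -/
theorem star_star_interval_not_surjective
    {𝔽 : Type*} [Field 𝔽] {n : ℕ} (hn : 1 ≤ n)
    (T T' : ZMod n → Type*)
    [∀ j, AddCommGroup (T j)] [∀ j, Module (PowerSeries 𝔽) (T j)]
    [∀ j, AddCommGroup (T' j)] [∀ j, Module (PowerSeries 𝔽) (T' j)]
    (hT : ∀ (j : ZMod n) (x : T j), ∃ r : PowerSeries 𝔽, r ≠ 0 ∧ r • x = 0)
    (hT' : ∀ (j : ZMod n) (x : T' j), ∃ r : PowerSeries 𝔽, r ≠ 0 ∧ r • x = 0)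
    (v : ∀ j : ZMod n, (PowerSeries 𝔽 × T j) →ₗ[PowerSeries 𝔽] (PowerSeries 𝔽 × T' j))
    (h : ∀ j : ZMod n, (PowerSeries 𝔽 × T j) →ₗ[PowerSeries 𝔽] (PowerSeries 𝔽 × T' (j + 1)))
    (D : (∀ j : ZMod n, PowerSeries 𝔽 × T j) → (∀ j : ZMod n, PowerSeries 𝔽 × T' j))
    (hD : ∀ (x : ∀ j : ZMod n, PowerSeries 𝔽 × T j) (j : ZMod n),
      D x (j + 1) = v (j + 1) (x (j + 1)) + h j (x j))
    (a : ZMod n) (ℓ : ℤ) (hℓ1 : 1 ≤ ℓ) (hℓn : ℓ ≤ (n : ℤ))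
    -- the index `a` has type ∗
    (ha : ¬ Surjective (fun x : PowerSeries 𝔽 × T a => (v a x).1) ∧
          ¬ Surjective (fun x : PowerSeries 𝔽 × T a => (h a x).1))
    -- the index `a + ℓ` has type ∗
    (haℓ : ¬ Surjective (fun x : PowerSeries 𝔽 × T (a + (ℓ : ZMod n)) =>
              (v (a + (ℓ : ZMod n)) x).1) ∧
           ¬ Surjective (fun x : PowerSeries 𝔽 × T (a + (ℓ : ZMod n)) =>
              (h (a + (ℓ : ZMod n)) x).1))
    -- every index strictly between has type ∘
    (hmid : ∀ t : ℤ, 0 < t → t < ℓ →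
      Surjective (fun x : PowerSeries 𝔽 × T (a + (t : ZMod n)) => (v (a + (t : ZMod n)) x).1) ∧
      Surjective (fun x : PowerSeries 𝔽 × T (a + (t : ZMod n)) => (h (a + (t : ZMod n)) x).1)) :
    ¬ Surjective D := by
  intro hsurj
  obtain ⟨x, hx⟩ := hsurj fun k => if k = a + 1 then (1, 0) else 0
  have hrow (k : ZMod n) : PowerSeries.constantCoeff (v (k + 1) (x (k + 1))).1 +
      PowerSeries.constantCoeff (h k (x k)).1 = if k = a then 1 else 0 := by
    have hk := congrArg (fun z => PowerSeries.constantCoeff z.1) (hD x k)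
    rw [hx] at hk
    simp only [Prod.fst_add, map_add, add_left_inj] at hk
    rw [← hk]
    split_ifs <;> simp
  have key (t : ℕ) (ht : (t : ℤ) + 1 ≤ ℓ) :
      PowerSeries.constantCoeff
        (v (a + ((t + 1 : ℤ) : ZMod n)) (x (a + ((t + 1 : ℤ) : ZMod n)))).1 ≠ 0 := by
    induction t with
    | zero =>
      have hcast : a + (((0 : ℕ) + 1 : ℤ) : ZMod n) = a + 1 := by simp
      have h0 := constantCoeff_eq_zero_of_not_surjective
        (LinearMap.fst _ _ _ ∘ₗ h a) ha.2 (x a)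
      have hr := hrow a
      simp only [LinearMap.comp_apply, LinearMap.fst_apply] at h0
      rw [h0, add_zero, if_pos rfl] at hr
      rw [hcast, hr]
      exact one_ne_zero
    | succ t ih =>
      have hcast : a + (((t + 1 : ℕ) + 1 : ℤ) : ZMod n) = a + ((t + 1 : ℤ) : ZMod n) + 1 := by
        push_cast
        ring
      push_cast at ht
      have hne : a + ((t + 1 : ℤ) : ZMod n) ≠ a := by
        rw [Ne, add_eq_left, ZMod.intCast_zmod_eq_zero_iff_dvd]
        intro hdvd
        have := Int.le_of_dvd (by omega) hdvd
        omega
      have hh := constantCoeff_ne_zero_of_surjective (hT _)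
        (LinearMap.fst _ _ _ ∘ₗ h _) (LinearMap.fst _ _ _ ∘ₗ v _)
        (hmid (t + 1) (by omega) (by omega)).2 (ih (by omega))
      have hr := hrow (a + ((t + 1 : ℤ) : ZMod n))
      rw [if_neg hne] at hr
      rw [hcast, eq_neg_of_add_eq_zero_left hr]
      exact neg_ne_zero.mpr hh
  obtain ⟨t, rfl⟩ : ∃ t : ℕ, ℓ = t + 1 := ⟨(ℓ - 1).toNat, by omega⟩
  exact key t le_rfl <| constantCoeff_eq_zero_of_not_surjective
    (LinearMap.fst _ _ _ ∘ₗ v _) haℓ.1 _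
end

section
/- Suppose there exist an index a ∈ ℤ/nℤ and an integer ℓ with 1 ≤ ℓ ≤ n such that the index a has type +, the index a+ℓ has type −, and, for every integer t with 0 < t < ℓ, the index a+t has type ∘. Then the map D is not surjective. (This is the case of the interval [+,−] in Lemma 5.2: a circular mapping cone containing a [+,−]-interval is not surjective.) -/
open Function

/-- A linear map out of `R × T` with `T` torsion, followed by the projection to the domain `R`,
is multiplication by an element. -/
theorem fst_apply_eq_mul {R T M : Type*} [CommRing R] [IsDomain R] [AddCommGroup T] [Module R T]
    [AddCommGroup M] [Module R M] (hT : ∀ x : T, ∃ r : R, r ≠ 0 ∧ r • x = 0)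
    (f : (R × T) →ₗ[R] (R × M)) (x : R × T) : (f x).1 = x.1 * (f (1, 0)).1 := by
  obtain ⟨r, hr, hrx⟩ := hT x.2
  have hzero : (f (0, x.2)).1 = 0 := by
    have hsmul : r • f (0, x.2) = 0 := by
      rw [← map_smul, Prod.smul_mk, hrx, smul_zero, Prod.mk_zero_zero, map_zero]
    have hfst : r * (f (0, x.2)).1 = 0 := by simpa using congrArg Prod.fst hsmul
    exact (mul_eq_zero.mp hfst).resolve_left hr
  have hx : x = x.1 • ((1, 0) : R × T) + (0, x.2) := by ext <;> simp
  conv_lhs => rw [hx, map_add, map_smul]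
  simp [hzero]

theorem constantCoeff_fst_apply_eq_zero_of_not_surjective {𝔽 T M : Type*} [Field 𝔽]
    [AddCommGroup T] [Module (PowerSeries 𝔽) T] [AddCommGroup M] [Module (PowerSeries 𝔽) M]
    (hT : ∀ x : T, ∃ r : PowerSeries 𝔽, r ≠ 0 ∧ r • x = 0)
    (f : (PowerSeries 𝔽 × T) →ₗ[PowerSeries 𝔽] (PowerSeries 𝔽 × M))
    (hf : ¬ Surjective (fun x => (f x).1)) (x : PowerSeries 𝔽 × T) :
    PowerSeries.constantCoeff (f x).1 = 0 := by
  suffices hc : PowerSeries.constantCoeff (f (1, 0)).1 = 0 by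
    rw [fst_apply_eq_mul hT f x, map_mul, hc, mul_zero]
  by_contra hc
  have hu : IsUnit (f (1, 0)).1 :=
    PowerSeries.isUnit_iff_constantCoeff.mpr (isUnit_iff_ne_zero.mpr hc)
  obtain ⟨s, hs⟩ := hu.exists_left_inv
  refine hf fun y => ⟨(y * s, 0), ?_⟩
  change (f (y * s, 0)).1 = y
  rw [fst_apply_eq_mul hT f, mul_assoc, hs, mul_one]

theorem constantCoeff_fst_eq_zero_of_surjective {𝔽 T M : Type*} [Field 𝔽]
    [AddCommGroup T] [Module (PowerSeries 𝔽) T] [AddCommGroup M] [Module (PowerSeries 𝔽) M]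
    (hT : ∀ x : T, ∃ r : PowerSeries 𝔽, r ≠ 0 ∧ r • x = 0)
    (f : (PowerSeries 𝔽 × T) →ₗ[PowerSeries 𝔽] (PowerSeries 𝔽 × M))
    (hf : Surjective (fun x => (f x).1)) {x : PowerSeries 𝔽 × T}
    (hx : PowerSeries.constantCoeff (f x).1 = 0) : PowerSeries.constantCoeff x.1 = 0 := by
  obtain ⟨y, hy⟩ := hf 1
  have hy' : y.1 * (f (1, 0)).1 = 1 := (fst_apply_eq_mul hT f y).symm.trans hy
  have hc : PowerSeries.constantCoeff (f (1, 0)).1 ≠ 0 := fun h0 => by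
    simpa [h0] using congrArg PowerSeries.constantCoeff hy'
  rw [fst_apply_eq_mul hT f x, map_mul] at hx
  exact (mul_eq_zero.mp hx).resolve_right hc

theorem plus_minus_interval_not_surjective
    {𝔽 : Type*} [Field 𝔽] {n : ℕ} (hn : 1 ≤ n)
    (T T' : ZMod n → Type*)
    [∀ j, AddCommGroup (T j)] [∀ j, Module (PowerSeries 𝔽) (T j)]
    [∀ j, AddCommGroup (T' j)] [∀ j, Module (PowerSeries 𝔽) (T' j)]
    (hT : ∀ (j : ZMod n) (x : T j), ∃ r : PowerSeries 𝔽, r ≠ 0 ∧ r • x = 0)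
    (hT' : ∀ (j : ZMod n) (x : T' j), ∃ r : PowerSeries 𝔽, r ≠ 0 ∧ r • x = 0)
    (v : ∀ j : ZMod n, (PowerSeries 𝔽 × T j) →ₗ[PowerSeries 𝔽] (PowerSeries 𝔽 × T' j))
    (h : ∀ j : ZMod n, (PowerSeries 𝔽 × T j) →ₗ[PowerSeries 𝔽] (PowerSeries 𝔽 × T' (j + 1)))
    (D : (∀ j : ZMod n, PowerSeries 𝔽 × T j) → (∀ j : ZMod n, PowerSeries 𝔽 × T' j))
    (hD : ∀ (x : ∀ j : ZMod n, PowerSeries 𝔽 × T j) (j : ZMod n),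
      D x (j + 1) = v (j + 1) (x (j + 1)) + h j (x j))
    (a : ZMod n) (ℓ : ℤ) (hℓ1 : 1 ≤ ℓ) (hℓn : ℓ ≤ (n : ℤ))
    -- the index `a` has type +
    (ha : Surjective (fun x : PowerSeries 𝔽 × T a => (v a x).1) ∧
          ¬ Surjective (fun x : PowerSeries 𝔽 × T a => (h a x).1))
    -- the index `a + ℓ` has type −
    (haℓ : Surjective (fun x : PowerSeries 𝔽 × T (a + (ℓ : ZMod n)) =>
              (h (a + (ℓ : ZMod n)) x).1) ∧
           ¬ Surjective (fun x : PowerSeries 𝔽 × T (a + (ℓ : ZMod n)) =>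
              (v (a + (ℓ : ZMod n)) x).1))
    -- every index strictly between has type ∘
    (hmid : ∀ t : ℤ, 0 < t → t < ℓ →
      Surjective (fun x : PowerSeries 𝔽 × T (a + (t : ZMod n)) => (v (a + (t : ZMod n)) x).1) ∧
      Surjective (fun x : PowerSeries 𝔽 × T (a + (t : ZMod n)) => (h (a + (t : ZMod n)) x).1)) :
    ¬ Surjective D := by
  intro hsurj
  lift ℓ to ℕ using by lia
  obtain ⟨m, rfl⟩ : ∃ m, ℓ = m + 1 := ⟨ℓ - 1, by lia⟩
  obtain ⟨x, hx⟩ := hsurj (Pi.single (a + (((m + 1 : ℕ) : ℤ) : ZMod n)) (1, 0))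
  have hstep : ∀ i j : ZMod n, i = j + 1 →
      PowerSeries.constantCoeff (D x i).1 =
        PowerSeries.constantCoeff (v i (x i)).1 + PowerSeries.constantCoeff (h j (x j)).1 := by
    rintro i j rfl
    rw [hD, Prod.fst_add, map_add]
  have hzero : ∀ k : ℕ, k ≤ m → ∀ j : ZMod n, j = a + ((k : ℤ) : ZMod n) →
      PowerSeries.constantCoeff (h j (x j)).1 = 0 := by
    intro k
    induction k with
    | zero =>
      intro _ j hj
      obtain rfl : j = a := by simpa using hj
      exact constantCoeff_fst_apply_eq_zero_of_not_surjective (hT j) (h j) ha.2 _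
    | succ k ih =>
      rintro hk j rfl
      have hne : a + (((k + 1 : ℕ) : ℤ) : ZMod n) ≠ a + (((m + 1 : ℕ) : ℤ) : ZMod n) := by
        intro heq
        have hdvd := (ZMod.intCast_eq_intCast_iff_dvd_sub _ _ _).mp (add_left_cancel heq)
        have := Int.le_of_dvd (by lia) hdvd
        lia
      have hprev := hstep (a + (((k + 1 : ℕ) : ℤ) : ZMod n)) (a + ((k : ℤ) : ZMod n))
        (by push_cast; ring)
      rw [hx, Pi.single_eq_of_ne hne, ih (by lia) _ rfl, add_zero, Prod.fst_zero, map_zero] at hprev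
      have hxj := constantCoeff_fst_eq_zero_of_surjective (hT _) (v _)
        (hmid ((k + 1 : ℕ) : ℤ) (by lia) (by lia)).1 hprev.symm
      rw [fst_apply_eq_mul (hT _) (h _), map_mul, hxj, zero_mul]
  have hlast := hstep (a + (((m + 1 : ℕ) : ℤ) : ZMod n)) (a + ((m : ℤ) : ZMod n))
    (by push_cast; ring)
  rw [hx, Pi.single_eq_same, hzero m le_rfl _ rfl,
    constantCoeff_fst_apply_eq_zero_of_not_surjective (hT _) (v _) haℓ.2] at hlast
  simp at hlast
end

section
/- Suppose there exist an index a ∈ ℤ/nℤ and an integer ℓ with 1 ≤ ℓ ≤ n such that the index a has type +, the index a+ℓ has type ∗, and, for every integer t with 0 < t < ℓ, the index a+t has type ∘. Then the map D is not surjective. (This is the case of the interval [+,∗] in Lemma 5.2: a circular mapping cone containing a [+,∗]-interval is not surjective.) -/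
open Function

/-- A linear functional on the sum of a domain and a torsion module is multiplication by a scalar
on the first factor. -/
theorem exists_apply_eq_mul_fst_of_torsion {R M : Type*} [CommRing R] [IsDomain R]
    [AddCommGroup M] [Module R M] (hM : ∀ x : M, ∃ r : R, r ≠ 0 ∧ r • x = 0)
    (f : (R × M) →ₗ[R] R) : ∃ c : R, ∀ x, f x = c * x.1 := by
  refine ⟨f (1, 0), fun x => ?_⟩
  obtain ⟨r, hr, hrx⟩ := hM x.2
  have h_torsion : f (0, x.2) = 0 := by
    have : r * f (0, x.2) = 0 := by
      rw [← smul_eq_mul, ← map_smul, Prod.smul_mk, hrx, smul_zero, Prod.mk_zero_zero, map_zero]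
    exact (mul_eq_zero.mp this).resolve_left hr
  have h_split : x = x.1 • ((1, 0) : R × M) + (0, x.2) := by ext <;> simp
  conv_lhs => rw [h_split]
  rw [map_add, map_smul, h_torsion, add_zero, smul_eq_mul, mul_comm]

theorem surjective_mul_fst_iff_isUnit {R M : Type*} [CommRing R] [Zero M] (c : R) :
    Surjective (fun x : R × M => c * x.1) ↔ IsUnit c := by
  constructor
  · intro hc
    obtain ⟨x, hx⟩ := hc 1
    exact .of_mul_eq_one _ hx
  · rintro ⟨u, rfl⟩ y
    exact ⟨(↑u⁻¹ * y, 0), by simp⟩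

/-- A torsion summand does not affect surjectivity onto `𝔽⟦X⟧`: a functional on
`𝔽⟦X⟧ × M` is, modulo `X`, multiplication by a scalar that vanishes iff the functional is not
surjective. -/
theorem exists_constantCoeff_apply_eq_mul {𝔽 M : Type*} [Field 𝔽]
    [AddCommGroup M] [Module (PowerSeries 𝔽) M]
    (hM : ∀ x : M, ∃ r : PowerSeries 𝔽, r ≠ 0 ∧ r • x = 0)
    (f : (PowerSeries 𝔽 × M) →ₗ[PowerSeries 𝔽] PowerSeries 𝔽) :
    ∃ c : 𝔽, (∀ x, PowerSeries.constantCoeff (f x) = c * PowerSeries.constantCoeff x.1) ∧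
      (Surjective f ↔ c ≠ 0) := by
  obtain ⟨c, hc⟩ := exists_apply_eq_mul_fst_of_torsion hM f
  refine ⟨PowerSeries.constantCoeff c, fun x => by rw [hc, map_mul], ?_⟩
  rw [show (f : PowerSeries 𝔽 × M → PowerSeries 𝔽) = fun x => c * x.1 from funext hc,
    surjective_mul_fst_iff_isUnit, PowerSeries.isUnit_iff_constantCoeff, isUnit_iff_ne_zero]

theorem plus_star_interval_not_surjective
    {𝔽 : Type*} [Field 𝔽] {n : ℕ} (hn : 1 ≤ n)
    (T T' : ZMod n → Type*)
    [∀ j, AddCommGroup (T j)] [∀ j, Module (PowerSeries 𝔽) (T j)]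
    [∀ j, AddCommGroup (T' j)] [∀ j, Module (PowerSeries 𝔽) (T' j)]
    (hT : ∀ (j : ZMod n) (x : T j), ∃ r : PowerSeries 𝔽, r ≠ 0 ∧ r • x = 0)
    (hT' : ∀ (j : ZMod n) (x : T' j), ∃ r : PowerSeries 𝔽, r ≠ 0 ∧ r • x = 0)
    (v : ∀ j : ZMod n, (PowerSeries 𝔽 × T j) →ₗ[PowerSeries 𝔽] (PowerSeries 𝔽 × T' j))
    (h : ∀ j : ZMod n, (PowerSeries 𝔽 × T j) →ₗ[PowerSeries 𝔽] (PowerSeries 𝔽 × T' (j + 1)))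
    (D : (∀ j : ZMod n, PowerSeries 𝔽 × T j) → (∀ j : ZMod n, PowerSeries 𝔽 × T' j))
    (hD : ∀ (x : ∀ j : ZMod n, PowerSeries 𝔽 × T j) (j : ZMod n),
      D x (j + 1) = v (j + 1) (x (j + 1)) + h j (x j))
    (a : ZMod n) (ℓ : ℤ) (hℓ1 : 1 ≤ ℓ) (hℓn : ℓ ≤ (n : ℤ))
    -- the index `a` has type +
    (ha : Surjective (fun x : PowerSeries 𝔽 × T a => (v a x).1) ∧
          ¬ Surjective (fun x : PowerSeries 𝔽 × T a => (h a x).1))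
    -- the index `a + ℓ` has type ∗
    (haℓ : ¬ Surjective (fun x : PowerSeries 𝔽 × T (a + (ℓ : ZMod n)) =>
              (v (a + (ℓ : ZMod n)) x).1) ∧
           ¬ Surjective (fun x : PowerSeries 𝔽 × T (a + (ℓ : ZMod n)) =>
              (h (a + (ℓ : ZMod n)) x).1))
    -- every index strictly between has type ∘
    (hmid : ∀ t : ℤ, 0 < t → t < ℓ →
      Surjective (fun x : PowerSeries 𝔽 × T (a + (t : ZMod n)) => (v (a + (t : ZMod n)) x).1) ∧
      Surjective (fun x : PowerSeries 𝔽 × T (a + (t : ZMod n)) => (h (a + (t : ZMod n)) x).1)) :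
    ¬ Surjective D := by
  choose c hc hc_surj using fun j =>
    exists_constantCoeff_apply_eq_mul (hT j) (LinearMap.fst _ _ _ ∘ₗ v j)
  choose d hd hd_surj using fun j =>
    exists_constantCoeff_apply_eq_mul (hT j) (LinearMap.fst _ _ _ ∘ₗ h j)
  have hda : d a = 0 := not_not.mp (mt (hd_surj a).mpr ha.2)
  have hcℓ : c (a + (ℓ : ZMod n)) = 0 := not_not.mp (mt (hc_surj _).mpr haℓ.1)
  have hc_mid (t : ℤ) (h0 : 0 < t) (h1 : t < ℓ) : c (a + (t : ZMod n)) ≠ 0 :=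
    (hc_surj _).mp (hmid t h0 h1).1
  intro hsurj
  obtain ⟨x, hx⟩ := hsurj (Pi.single (a + (ℓ : ZMod n)) (1, 0))
  have h_coeff (j : ZMod n) : PowerSeries.constantCoeff (D x (j + 1)).1 =
      c (j + 1) * PowerSeries.constantCoeff (x (j + 1)).1 +
        d j * PowerSeries.constantCoeff (x j).1 := by
    rw [hD, Prod.fst_add, map_add]
    exact congrArg₂ (· + ·) (hc _ _) (hd _ _)
  have h_zero (k : ℕ) : (k : ℤ) < ℓ →
      d (a + (k : ZMod n)) * PowerSeries.constantCoeff (x (a + (k : ZMod n))).1 = 0 := by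
    induction k with
    | zero => simp [hda]
    | succ k ih =>
      intro hk
      push_cast at hk
      have h_ne : a + (k : ZMod n) + 1 ≠ a + (ℓ : ZMod n) := by
        intro heq
        have h_cast : (((k : ℤ) + 1 : ℤ) : ZMod n) = (ℓ : ZMod n) := by
          push_cast
          exact add_left_cancel (by rw [← add_assoc, heq])
        have h_dvd := (ZMod.intCast_eq_intCast_iff_dvd_sub _ _ _).mp h_cast
        have := Int.le_of_dvd (by omega) h_dvd
        omega
      have h_eq := h_coeff (a + (k : ZMod n))
      rw [ih (by omega), hx, Pi.single_eq_of_ne h_ne, Prod.fst_zero, map_zero, add_zero] at h_eq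
      have h_c := hc_mid (k + 1) (by omega) hk
      push_cast at h_c
      rw [← add_assoc] at h_c
      rw [Nat.cast_succ, ← add_assoc, (mul_eq_zero.mp h_eq.symm).resolve_left h_c, mul_zero]
  obtain ⟨m, rfl⟩ : ∃ m : ℕ, ℓ = m + 1 := ⟨(ℓ - 1).toNat, by omega⟩
  have h_last : a + (m : ZMod n) + 1 = a + (((m : ℤ) + 1 : ℤ) : ZMod n) := by
    push_cast
    rw [add_assoc]
  have h_eq := h_coeff (a + (m : ZMod n))
  rw [h_zero m (by omega), h_last, hcℓ, hx, Pi.single_eq_same] at h_eq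
  simp at h_eq
end

section
/- Suppose there exist an index a ∈ ℤ/nℤ and an integer ℓ with 1 ≤ ℓ ≤ n such that the index a has type ∗, the index a+ℓ has type −, and, for every integer t with 0 < t < ℓ, the index a+t has type ∘. Then the map D is not surjective. (This is the case of the interval [∗,−] in Lemma 5.2: a circular mapping cone containing a [∗,−]-interval is not surjective.) -/
open Function

section Tower

variable {R T M : Type*} [CommRing R] [AddCommGroup T] [Module R T] [AddCommGroup M] [Module R M]

/-- A linear functional with a unit value is surjective. -/
theorem surjective_of_isUnit_apply (f : M →ₗ[R] R) {x : M} (hx : IsUnit (f x)) :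
    Surjective f := by
  obtain ⟨u, hu⟩ := hx
  intro y
  exact ⟨(y * ↑u⁻¹) • x, by simp [← hu]⟩

/-- A linear functional on the direct sum of a domain and a torsion module only depends on the
first coordinate. -/
theorem apply_eq_fst_mul_of_torsion [IsDomain R] (hT : ∀ t : T, ∃ r : R, r ≠ 0 ∧ r • t = 0)
    (f : R × T →ₗ[R] R) (x : R × T) : f x = x.1 * f (1, 0) := by
  have htors : f (0, x.2) = 0 := by
    obtain ⟨r, hr, hrt⟩ := hT x.2
    have : r * f (0, x.2) = 0 := by
      rw [← smul_eq_mul, ← map_smul, Prod.smul_mk, hrt, smul_zero, Prod.mk_zero_zero, map_zero]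
    exact (mul_eq_zero.mp this).resolve_left hr
  have hx : x = x.1 • ((1, 0) : R × T) + (0, x.2) := by ext <;> simp
  conv_lhs => rw [hx]
  rw [map_add, map_smul, htors, add_zero, smul_eq_mul]

/-- A surjective linear functional on the direct sum of a domain and a torsion module takes unit
values exactly at the elements whose first coordinate is a unit. -/
theorem isUnit_apply_iff_of_surjective [IsDomain R] (hT : ∀ t : T, ∃ r : R, r ≠ 0 ∧ r • t = 0)
    (f : R × T →ₗ[R] R) (hf : Surjective f) (x : R × T) : IsUnit (f x) ↔ IsUnit x.1 := by
  have hunit : IsUnit (f (1, 0)) := by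
    obtain ⟨y, hy⟩ := hf 1
    rw [apply_eq_fst_mul_of_torsion hT] at hy
    exact IsUnit.of_mul_eq_one_right _ hy
  rw [apply_eq_fst_mul_of_torsion hT, IsUnit.mul_iff, and_iff_left hunit]

end Tower

theorem star_minus_interval_not_surjective
    {𝔽 : Type*} [Field 𝔽] {n : ℕ} (hn : 1 ≤ n)
    (T T' : ZMod n → Type*)
    [∀ j, AddCommGroup (T j)] [∀ j, Module (PowerSeries 𝔽) (T j)]
    [∀ j, AddCommGroup (T' j)] [∀ j, Module (PowerSeries 𝔽) (T' j)]
    (hT : ∀ (j : ZMod n) (x : T j), ∃ r : PowerSeries 𝔽, r ≠ 0 ∧ r • x = 0)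
    (hT' : ∀ (j : ZMod n) (x : T' j), ∃ r : PowerSeries 𝔽, r ≠ 0 ∧ r • x = 0)
    (v : ∀ j : ZMod n, (PowerSeries 𝔽 × T j) →ₗ[PowerSeries 𝔽] (PowerSeries 𝔽 × T' j))
    (h : ∀ j : ZMod n, (PowerSeries 𝔽 × T j) →ₗ[PowerSeries 𝔽] (PowerSeries 𝔽 × T' (j + 1)))
    (D : (∀ j : ZMod n, PowerSeries 𝔽 × T j) → (∀ j : ZMod n, PowerSeries 𝔽 × T' j))
    (hD : ∀ (x : ∀ j : ZMod n, PowerSeries 𝔽 × T j) (j : ZMod n),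
      D x (j + 1) = v (j + 1) (x (j + 1)) + h j (x j))
    (a : ZMod n) (ℓ : ℤ) (hℓ1 : 1 ≤ ℓ) (hℓn : ℓ ≤ (n : ℤ))
    -- the index `a` has type ∗
    (ha : ¬ Surjective (fun x : PowerSeries 𝔽 × T a => (v a x).1) ∧
          ¬ Surjective (fun x : PowerSeries 𝔽 × T a => (h a x).1))
    -- the index `a + ℓ` has type −
    (haℓ : Surjective (fun x : PowerSeries 𝔽 × T (a + (ℓ : ZMod n)) =>
              (h (a + (ℓ : ZMod n)) x).1) ∧
           ¬ Surjective (fun x : PowerSeries 𝔽 × T (a + (ℓ : ZMod n)) =>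
              (v (a + (ℓ : ZMod n)) x).1))
    -- every index strictly between has type ∘
    (hmid : ∀ t : ℤ, 0 < t → t < ℓ →
      Surjective (fun x : PowerSeries 𝔽 × T (a + (t : ZMod n)) => (v (a + (t : ZMod n)) x).1) ∧
      Surjective (fun x : PowerSeries 𝔽 × T (a + (t : ZMod n)) => (h (a + (t : ZMod n)) x).1)) :
    ¬ Surjective D := by
  intro hsurj
  lift ℓ to ℕ using by lia
  obtain ⟨x, hx⟩ := hsurj (Pi.single (a + 1) (1, 0))
  have hsum (j : ZMod n) : (v (j + 1) (x (j + 1))).1 + (h j (x j)).1 =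
      ((Pi.single (a + 1) (1, 0) : ∀ j : ZMod n, PowerSeries 𝔽 × T' j) (j + 1)).1 := by
    rw [← hx, hD, Prod.fst_add]
  have hstep (k : ℕ) (hk : k + 1 ≤ ℓ) (j : ZMod n) (hj : j = a + (k : ZMod n)) :
      IsUnit (v (j + 1) (x (j + 1))).1 := by
    induction k generalizing j with
    | zero =>
      obtain rfl : j = a := by simpa using hj
      have hone := hsum j
      rw [Pi.single_eq_same] at hone
      refine (IsLocalRing.isUnit_or_isUnit_of_add_one hone).resolve_right fun hu => ha.2 ?_
      exact surjective_of_isUnit_apply (LinearMap.fst _ _ _ ∘ₗ h j) hu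
    | succ k ih =>
      obtain ⟨i, rfl⟩ : ∃ i, j = i + 1 := ⟨j - 1, by ring⟩
      have hi : i = a + (k : ZMod n) := by
        push_cast at hj
        linear_combination hj
      have hne : i + 1 + 1 ≠ a + 1 := by
        intro heq
        have hzero : ((k + 1 : ℕ) : ZMod n) = 0 := by
          push_cast
          linear_combination heq - hi
        have := Nat.le_of_dvd (Nat.succ_pos k) ((ZMod.natCast_eq_zero_iff _ _).mp hzero)
        lia
      have hzero := hsum (i + 1)
      rw [Pi.single_eq_of_ne hne, Prod.fst_zero] at hzero
      have hcirc : Surjective (fun y => (v (i + 1) y).1) ∧ Surjective (fun y => (h (i + 1) y).1) := by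
        have := hmid ((k + 1 : ℕ) : ℤ) (by lia) (by lia)
        rwa [Int.cast_natCast, ← hj] at this
      have hxi : IsUnit (x (i + 1)).1 :=
        (isUnit_apply_iff_of_surjective (hT _) (LinearMap.fst _ _ _ ∘ₗ v (i + 1)) hcirc.1 _).mp
          (ih (by lia) i hi)
      rw [eq_neg_of_add_eq_zero_left hzero, IsUnit.neg_iff]
      exact (isUnit_apply_iff_of_surjective (hT _) (LinearMap.fst _ _ _ ∘ₗ h (i + 1))
        hcirc.2 _).mpr hxi
  have hlast : a + ((ℓ - 1 : ℕ) : ZMod n) + 1 = a + ((ℓ : ℤ) : ZMod n) := by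
    rw [Nat.cast_sub (by lia)]
    push_cast
    ring
  have hu := hstep (ℓ - 1) (by lia) _ rfl
  rw [hlast] at hu
  exact haℓ.2 (surjective_of_isUnit_apply (LinearMap.fst _ _ _ ∘ₗ v _) hu)
end

section
/- If some index j₀ ∈ ℤ/nℤ has type ∗, that is, neither π_{j₀} ∘ v_{j₀} nor π_{j₀+1} ∘ h_{j₀} is surjective, then the map D is not surjective. (This is Lemma 5.3: the circular mapping cone 𝔇⁻_𝔰 : 𝔄⁻_𝔰 → 𝔅⁻_𝔰 is not surjective whenever 𝔄⁻_𝔰 contains a summand of type ∗.) -/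
open Function

namespace PowerSeries

variable {𝔽 : Type*} [Field 𝔽] {T : Type*} [AddCommGroup T] [Module (PowerSeries 𝔽) T]

/-- A functional on `R × T` with `T` torsion is multiplication by its value at `(1, 0)`. -/
theorem apply_eq_fst_mul_of_torsion
    (hT : ∀ x : T, ∃ r : PowerSeries 𝔽, r ≠ 0 ∧ r • x = 0)
    (f : (PowerSeries 𝔽 × T) →ₗ[PowerSeries 𝔽] PowerSeries 𝔽) (x : PowerSeries 𝔽 × T) :
    f x = x.1 * f (1, 0) := by
  obtain ⟨r, hr, hrx⟩ := hT x.2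
  have htors : f (0, x.2) = 0 := by
    have h0 : r • f (0, x.2) = 0 := by
      rw [← map_smul, Prod.smul_mk, hrx, smul_zero, Prod.mk_zero_zero, map_zero]
    exact (smul_eq_zero.mp h0).resolve_left hr
  have hx : x = x.1 • ((1, 0) : PowerSeries 𝔽 × T) + (0, x.2) := by
    ext <;> simp
  conv_lhs => rw [hx, map_add, map_smul, htors, add_zero, smul_eq_mul]

theorem constantCoeff_apply_eq_zero_of_not_surjective
    (f : (PowerSeries 𝔽 × T) →ₗ[PowerSeries 𝔽] PowerSeries 𝔽) (hf : ¬ Surjective f) :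
    constantCoeff (f (1, 0)) = 0 := by
  by_contra hc
  refine hf fun r => ⟨(r * (f (1, 0))⁻¹) • (1, 0), ?_⟩
  rw [map_smul, smul_eq_mul, mul_assoc, PowerSeries.inv_mul_cancel _ hc, mul_one]

end PowerSeries

/-- A cyclic bidiagonal matrix over a field with a vanishing column is not surjective. -/
theorem not_surjective_cyclic_bidiagonal {𝔽 : Type*} [Field 𝔽] {n : ℕ} [NeZero n]
    (α β : ZMod n → 𝔽) (j₀ : ZMod n) (hα : α j₀ = 0) (hβ : β j₀ = 0) :
    ¬ ∀ z : ZMod n → 𝔽, ∃ y : ZMod n → 𝔽,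
      ∀ j, α (j + 1) * y (j + 1) + β j * y j = z (j + 1) := by
  intro hsurj
  let L : (ZMod n → 𝔽) →ₗ[𝔽] (ZMod n → 𝔽) :=
    { toFun := fun y j => α (j + 1) * y (j + 1) + β j * y j
      map_add' := fun x y => by ext j; simp only [Pi.add_apply]; ring
      map_smul' := fun c y => by
        ext j; simp only [Pi.smul_apply, smul_eq_mul, RingHom.id_apply]; ring }
  have hL : Surjective L := fun z => by
    obtain ⟨y, hy⟩ := hsurj fun j => z (j - 1)
    exact ⟨y, funext fun j => (hy j).trans (by rw [add_sub_cancel_right])⟩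
  have hker : L (Pi.single j₀ 1) = L 0 := by
    have hmul (γ : ZMod n → 𝔽) (hγ : γ j₀ = 0) (j : ZMod n) :
        γ j * (Pi.single j₀ 1 : ZMod n → 𝔽) j = 0 := by
      by_cases hj : j = j₀
      · rw [hj, hγ, zero_mul]
      · rw [Pi.single_eq_of_ne hj, mul_zero]
    rw [map_zero]
    ext j
    change α (j + 1) * (Pi.single j₀ 1 : ZMod n → 𝔽) (j + 1) +
      β j * (Pi.single j₀ 1 : ZMod n → 𝔽) j = 0
    rw [hmul α hα, hmul β hβ, add_zero]
  have hsingle := congrFun (LinearMap.injective_iff_surjective.mpr hL hker) j₀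
  simp at hsingle

/-- Lemma 5.3: the circular mapping cone `D` is not surjective whenever some index `j₀` has
type ∗, i.e. neither `π_{j₀} ∘ v_{j₀}` nor `π_{j₀+1} ∘ h_{j₀}` is surjective. -/
theorem circular_cone_not_surjective_of_star
    {𝔽 : Type*} [Field 𝔽] {n : ℕ} (hn : 1 ≤ n)
    (T T' : ZMod n → Type*)
    [∀ j, AddCommGroup (T j)] [∀ j, Module (PowerSeries 𝔽) (T j)]
    [∀ j, AddCommGroup (T' j)] [∀ j, Module (PowerSeries 𝔽) (T' j)]
    (hT : ∀ (j : ZMod n) (x : T j), ∃ r : PowerSeries 𝔽, r ≠ 0 ∧ r • x = 0)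
    (hT' : ∀ (j : ZMod n) (x : T' j), ∃ r : PowerSeries 𝔽, r ≠ 0 ∧ r • x = 0)
    (v : ∀ j : ZMod n, (PowerSeries 𝔽 × T j) →ₗ[PowerSeries 𝔽] (PowerSeries 𝔽 × T' j))
    (h : ∀ j : ZMod n, (PowerSeries 𝔽 × T j) →ₗ[PowerSeries 𝔽] (PowerSeries 𝔽 × T' (j + 1)))
    (D : (∀ j : ZMod n, PowerSeries 𝔽 × T j) → (∀ j : ZMod n, PowerSeries 𝔽 × T' j))
    (hD : ∀ (x : ∀ j : ZMod n, PowerSeries 𝔽 × T j) (j : ZMod n),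
      D x (j + 1) = v (j + 1) (x (j + 1)) + h j (x j))
    (j₀ : ZMod n)
    -- the index `j₀` has type ∗
    (hj₀ : ¬ Surjective (fun x : PowerSeries 𝔽 × T j₀ => (v j₀ x).1) ∧
           ¬ Surjective (fun x : PowerSeries 𝔽 × T j₀ => (h j₀ x).1)) :
    ¬ Surjective D := by
  intro hsurj
  have : NeZero n := ⟨by omega⟩
  let f (j : ZMod n) := LinearMap.fst (PowerSeries 𝔽) (PowerSeries 𝔽) (T' j) ∘ₗ v j
  let g (j : ZMod n) := LinearMap.fst (PowerSeries 𝔽) (PowerSeries 𝔽) (T' (j + 1)) ∘ₗ h j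
  refine not_surjective_cyclic_bidiagonal
    (fun j => PowerSeries.constantCoeff (f j (1, 0)))
    (fun j => PowerSeries.constantCoeff (g j (1, 0))) j₀
    (PowerSeries.constantCoeff_apply_eq_zero_of_not_surjective (f j₀) hj₀.1)
    (PowerSeries.constantCoeff_apply_eq_zero_of_not_surjective (g j₀) hj₀.2) fun z => ?_
  obtain ⟨x, hx⟩ := hsurj fun j => (PowerSeries.C (z j), 0)
  refine ⟨fun j => PowerSeries.constantCoeff (x j).1, fun j => ?_⟩
  have hfst : f (j + 1) (x (j + 1)) + g j (x j) = PowerSeries.C (z (j + 1)) := by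
    have hj := hD x j
    rw [hx] at hj
    exact (congrArg Prod.fst hj).symm
  rw [PowerSeries.apply_eq_fst_mul_of_torsion (hT _) (f (j + 1)),
    PowerSeries.apply_eq_fst_mul_of_torsion (hT _) (g j)] at hfst
  have hcoeff := congrArg PowerSeries.constantCoeff hfst
  rw [map_add, map_mul, map_mul, PowerSeries.constantCoeff_C] at hcoeff
  rw [← hcoeff]
  ring
end

section
/- There is a unique integer n₀ with V(n₀) = H(n₀), and exactly one of the following two alternatives holds. Type (i): V(n₀) = H(n₀) = 0, for every n < n₀ one has V(n) > 0 and H(n) = 0, and for every n > n₀ one has H(n) > 0 and V(n) = 0 (so n₀ is the unique index of type ∘, and all other indices are of type + or −). Type (ii): V(n₀) = H(n₀) > 0, there is no integer n with V(n) = H(n) = 0, the set S = {n ∈ ℤ : V(n) > 0 and H(n) > 0} is a nonempty finite set of consecutive integers containing n₀, for every n < min S one has V(n) > 0 and H(n) = 0, and for every n > max S one has H(n) > 0 and V(n) = 0 (so the indices of type ∗ form a nonempty block of consecutive integers and all other indices are of type + or −). -/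
/-- An integer sequence decreasing by one at each step is `n ↦ f 0 - n`. -/
theorem Int.eq_sub_of_succ_eq_sub_one {f : ℤ → ℤ} (hf : ∀ n, f (n + 1) = f n - 1) (n : ℤ) :
    f n = f 0 - n := by
  induction n using Int.induction_on with
  | zero => simp
  | succ k ih => rw [hf, ih]; ring
  | pred k ih =>
    have h := hf (-(k : ℤ) - 1)
    rw [sub_add_cancel] at h
    linarith

/-- The classification of `𝔊⁻_𝔱(Y,K)` into the two types of Table 1. Given sequences
`V H : ℤ → ℕ` satisfying the monotonicity properties (2.3), (2.4) and the difference
property of Lemma 2.2, with `V` eventually zero above and `H` eventually zero below,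
there is a unique integer `n₀` with `V n₀ = H n₀`, and exactly one of the following holds:
Type (i): `V n₀ = H n₀ = 0`, all smaller indices have type − and all larger have type +;
Type (ii): `V n₀ = H n₀ > 0`, no index has type ∘, the indices of type ∗ form a nonempty
finite block `[m, M]` of consecutive integers containing `n₀`, all indices below `m` have
type − and all indices above `M` have type +. -/
theorem classification_of_VH_types
    (V H : ℤ → ℕ)
    (hV : ∀ n : ℤ, V (n + 1) ≤ V n ∧ V n ≤ V (n + 1) + 1)
    (hH : ∀ n : ℤ, H n ≤ H (n + 1) ∧ H (n + 1) ≤ H n + 1)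
    (hVH : ∀ n : ℤ, (V (n + 1) : ℤ) - (H (n + 1) : ℤ) = (V n : ℤ) - (H n : ℤ) - 1)
    (hVtop : ∃ N : ℤ, ∀ n ≥ N, V n = 0)
    (hHbot : ∃ N : ℤ, ∀ n ≤ N, H n = 0) :
    ∃ n₀ : ℤ, V n₀ = H n₀ ∧ (∀ m : ℤ, V m = H m → m = n₀) ∧
      Xor'
        -- Type (i)
        (V n₀ = 0 ∧ H n₀ = 0 ∧
          (∀ n < n₀, 0 < V n ∧ H n = 0) ∧
          (∀ n > n₀, V n = 0 ∧ 0 < H n))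
        -- Type (ii)
        (0 < V n₀ ∧ 0 < H n₀ ∧
          (¬ ∃ n : ℤ, V n = 0 ∧ H n = 0) ∧
          ∃ m M : ℤ, m ≤ n₀ ∧ n₀ ≤ M ∧
            (∀ n : ℤ, (0 < V n ∧ 0 < H n) ↔ (m ≤ n ∧ n ≤ M)) ∧
            (∀ n < m, 0 < V n ∧ H n = 0) ∧
            (∀ n > M, V n = 0 ∧ 0 < H n)) := by
  have hVanti : Antitone V := antitone_int_of_succ_le fun n => (hV n).1
  have hHmono : Monotone H := monotone_int_of_le_succ fun n => (hH n).1
  have hdiff (n : ℤ) : (V n : ℤ) - H n = (V 0 : ℤ) - H 0 - n :=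
    Int.eq_sub_of_succ_eq_sub_one (f := fun n => (V n : ℤ) - H n) hVH n
  obtain ⟨n₀, hn₀⟩ : ∃ n₀ : ℤ, n₀ = (V 0 : ℤ) - H 0 := ⟨_, rfl⟩
  rw [← hn₀] at hdiff
  have heq : V n₀ = H n₀ := by have := hdiff n₀; omega
  refine ⟨n₀, heq, fun m hm => by have := hdiff m; omega, ?_⟩
  rcases Nat.eq_zero_or_pos (V n₀) with h0 | hpos
  · refine Or.inl ⟨⟨h0, by omega, fun n hn => ?_, fun n hn => ?_⟩, fun h => by omega⟩
    · have := hHmono hn.le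
      have := hdiff n
      omega
    · have := hVanti hn.le
      have := hdiff n
      omega
  · obtain ⟨A, hA⟩ := hVtop
    obtain ⟨B, hB⟩ := hHbot
    obtain ⟨M, hM, hMmax⟩ := Int.exists_greatest_of_bdd (P := fun n => 0 < V n)
      ⟨A, fun z hz => by by_contra! h; have := hA z h.le; omega⟩ ⟨n₀, hpos⟩
    obtain ⟨m, hm, hmmin⟩ := Int.exists_least_of_bdd (P := fun n => 0 < H n)
      ⟨B, fun z hz => by by_contra! h; have := hB z h.le; omega⟩ ⟨n₀, heq ▸ hpos⟩
    have hmn₀ : m ≤ n₀ := hmmin n₀ (heq ▸ hpos)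
    have hn₀M : n₀ ≤ M := hMmax n₀ hpos
    refine Or.inr ⟨⟨hpos, heq ▸ hpos, ?_, m, M, hmn₀, hn₀M, fun n => ?_, fun n hn => ?_,
      fun n hn => ?_⟩, fun h => by omega⟩
    · rintro ⟨n, hVn, hHn⟩
      have := hdiff n
      obtain rfl : n = n₀ := by omega
      omega
    · exact ⟨fun h => ⟨hmmin n h.2, hMmax n h.1⟩,
        fun h => ⟨hM.trans_le (hVanti h.2), hm.trans_le (hHmono h.1)⟩⟩
    · refine ⟨hpos.trans_le (hVanti (hn.le.trans hmn₀)), ?_⟩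
      by_contra h
      exact hn.not_ge (hmmin n (Nat.pos_of_ne_zero h))
    · refine ⟨?_, (heq ▸ hpos : 0 < H n₀).trans_le (hHmono (hn₀M.trans hn.le))⟩
      by_contra h
      exact hn.not_ge (hMmax n (Nat.pos_of_ne_zero h))
end
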